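/- Let p be a real number with 0 < p < 1. For Lebesgue-almost every irrational x ∈ (0,1), the generalized p-mean of the negative continued fraction digits converges to 2: lim_{n→∞} ((1/n) ∑_{k=1}^{n} a'_k(x)^p)^{1/p} = 2. -/

import Mathlib

open MeasureTheory Filter Real

/-- The negative continued fraction map `T(y) = -1/y - ⌊-1/y⌋` (with `T 0 = 0`). -/
noncomputable def negT (y : ℝ) : ℝ := Int.fract (-1 / y)

/-- The `n`-th negative continued fraction digit `a'_n(x) = ⌈1 / T^{n-1}(1-x)⌉`. -/
noncomputable def negDigit (x : ℝ) (n : ℕ) : ℕ := (⌈1 / negT^[n - 1] (1 - x)⌉).toNat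

/-- The Gauss map of regular continued fractions. -/
noncomputable def gaussMap (x : ℝ) : ℝ := Int.fract x⁻¹

/-- The first regular continued fraction digit. -/
noncomputable def gaussDigit (x : ℝ) : ℕ := ⌊x⁻¹⌋₊

/-- The density `(1 + c) / (1 + c x)²` of the Gauss map image of normalized Lebesgue measure on
a cylinder. -/
noncomputable def cylDensity (c x : ℝ) : ENNReal := ENNReal.ofReal ((1 + c) / (1 + c * x) ^ 2)

/-- The measure on `(0, 1)` with density `cylDensity c`. -/
noncomputable def cylMeasure (c : ℝ) : Measure ℝ :=
  (volume.restrict (Set.Ioo 0 1)).withDensity (cylDensity c)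

@[fun_prop]
lemma measurable_gaussMap : Measurable gaussMap := measurable_inv.fract

@[fun_prop]
lemma measurable_gaussDigit : Measurable gaussDigit := Nat.measurable_floor.comp measurable_inv

@[fun_prop]
lemma measurable_gaussMap_iterate (n : ℕ) : Measurable (gaussMap^[n]) :=
  measurable_gaussMap.iterate n

@[fun_prop]
lemma measurable_cylDensity (c : ℝ) : Measurable (cylDensity c) := by
  unfold cylDensity
  fun_prop

lemma lintegral_cylMeasure (c : ℝ) {f : ℝ → ENNReal} (hf : Measurable f) :
    ∫⁻ x, f x ∂cylMeasure c = ∫⁻ x in Set.Ioo 0 1, cylDensity c x * f x := by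
  rw [cylMeasure, lintegral_withDensity_eq_lintegral_mul _ (measurable_cylDensity c) hf]
  rfl

lemma cylMeasure_zero : cylMeasure 0 = volume.restrict (Set.Ioo 0 1) := by
  have : cylDensity 0 = 1 := by
    ext x
    simp [cylDensity]
  rw [cylMeasure, this, withDensity_one]

lemma cylMeasure_univ {c : ℝ} (hc : 0 ≤ c) : cylMeasure c Set.univ = 1 := by
  rw [← lintegral_one, lintegral_cylMeasure c measurable_const]
  simp only [mul_one]
  have hpos : ∀ x ∈ Set.uIcc (0 : ℝ) 1, 1 + c * x ≠ 0 := by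
    intro x hx
    rw [Set.uIcc_of_le zero_le_one] at hx
    have := mul_nonneg hc hx.1
    positivity
  have hcont : ContinuousOn (fun x : ℝ => (1 + c) / (1 + c * x) ^ 2) (Set.uIcc 0 1) := by
    refine ContinuousOn.div (by fun_prop) (by fun_prop) fun x hx => pow_ne_zero _ (hpos x hx)
  have hint := hcont.intervalIntegrable (μ := volume)
  have hval : ∫ x in (0 : ℝ)..1, (1 + c) / (1 + c * x) ^ 2 = 1 := by
    rw [intervalIntegral.integral_eq_sub_of_hasDerivAt
      (f := fun x => (1 + c) * x / (1 + c * x)) ?_ hint]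
    · have : 1 + c ≠ 0 := by positivity
      simp [this]
    · intro x hx
      have h1 : HasDerivAt (fun x : ℝ => (1 + c) * x) (1 + c) x := by
        simpa using (hasDerivAt_id x).const_mul (1 + c)
      have h2 : HasDerivAt (fun x : ℝ => 1 + c * x) c x := by
        simpa using ((hasDerivAt_id x).const_mul c).const_add 1
      refine (h1.div h2 (hpos x hx)).congr_deriv ?_
      congr 1
      ring
  rw [restrict_Ioo_eq_restrict_Ioc]
  unfold cylDensity
  rw [← ofReal_integral_eq_lintegral_ofReal]
  · rw [← intervalIntegral.integral_of_le zero_le_one, hval, ENNReal.ofReal_one]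
  · exact (intervalIntegrable_iff_integrableOn_Ioc_of_le zero_le_one).1 hint
  · exact Eventually.of_forall fun x => by positivity

lemma image_inv_natCast_add {k : ℕ} (hk : 1 ≤ k) :
    (fun y : ℝ => ((k : ℝ) + y)⁻¹) '' Set.Ico 0 1 = {x ∈ Set.Ioc (0 : ℝ) 1 | gaussDigit x = k} := by
  have hk' : (1 : ℝ) ≤ k := by exact_mod_cast hk
  ext x
  constructor
  · rintro ⟨y, ⟨hy0, hy1⟩, rfl⟩
    refine ⟨⟨by positivity, inv_le_one_of_one_le₀ (by linarith)⟩, ?_⟩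
    rw [gaussDigit, inv_inv, Nat.floor_eq_iff (by positivity)]
    constructor <;> linarith
  · rintro ⟨⟨hx0, hx1⟩, hx⟩
    refine ⟨Int.fract x⁻¹, ⟨Int.fract_nonneg _, Int.fract_lt_one _⟩, ?_⟩
    have : ((gaussDigit x : ℕ) : ℝ) = (⌊x⁻¹⌋ : ℝ) := by
      rw [gaussDigit, natCast_floor_eq_intCast_floor (by positivity)]
    simp only
    rw [← hx, this, Int.floor_add_fract, inv_inv]

/-- The conditional law of the Gauss map on a cylinder is again one of the `cylMeasure`s. -/
lemma setLIntegral_gaussMap {c : ℝ} (hc : 0 ≤ c) {k : ℕ} (hk : 1 ≤ k) {f : ℝ → ENNReal}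
    (hf : Measurable f) :
    ∫⁻ x in {x ∈ Set.Ioc (0 : ℝ) 1 | gaussDigit x = k}, cylDensity c x * f (gaussMap x) =
      ENNReal.ofReal ((1 + c) / ((k + c) * (k + c + 1))) *
        ∫⁻ y, f y ∂cylMeasure (1 / (k + c)) := by
  have hk' : (1 : ℝ) ≤ k := by exact_mod_cast hk
  rw [lintegral_cylMeasure _ hf, ← image_inv_natCast_add hk,
    lintegral_image_eq_lintegral_abs_deriv_mul measurableSet_Ico
      (f' := fun y : ℝ => -1 / ((k : ℝ) + y) ^ 2),
    ← lintegral_const_mul _ (by fun_prop), Measure.restrict_congr_set Ioo_ae_eq_Ico]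
  · refine setLIntegral_congr_fun measurableSet_Ico fun y hy => ?_
    have hy0 := hy.1
    have hfr : gaussMap ((k : ℝ) + y)⁻¹ = y := by
      rw [gaussMap, inv_inv, Int.fract_natCast_add, Int.fract_eq_self.2 hy]
    rw [hfr, ← mul_assoc, ← mul_assoc]
    congr 1
    unfold cylDensity
    rw [← ENNReal.ofReal_mul (by positivity), ← ENNReal.ofReal_mul (by positivity)]
    congr 1
    rw [neg_div, abs_neg, abs_of_pos (by positivity)]
    have h1 : (k : ℝ) + y ≠ 0 := by positivity
    have h2 : (k : ℝ) + c ≠ 0 := by positivity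
    have h3 : (k : ℝ) + c + 1 ≠ 0 := by positivity
    have h4 : (k : ℝ) + y + c ≠ 0 := by positivity
    have e1 : 1 + c * ((k : ℝ) + y)⁻¹ = (k + y + c) / (k + y) := by field_simp
    have e2 : 1 + 1 / ((k : ℝ) + c) * y = (k + y + c) / (k + c) := by field_simp; ring
    have e3 : 1 + 1 / ((k : ℝ) + c) = (k + c + 1) / (k + c) := by field_simp
    rw [e1, e2, e3]
    field_simp
  · intro y hy
    have hy0 := hy.1
    have h1 : (k : ℝ) + y ≠ 0 := by positivity
    exact (((hasDerivAt_id y).const_add (k : ℝ)).inv h1).hasDerivWithinAt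
  · intro y _ z _ h
    simpa using h

lemma lintegral_cylMeasure_eq_tsum (c : ℝ) {f : ℝ → ENNReal} (hf : Measurable f) :
    ∫⁻ x, f x ∂cylMeasure c =
      ∑' k : ℕ, ∫⁻ x in {x ∈ Set.Ioc (0 : ℝ) 1 | gaussDigit x = k + 1},
        cylDensity c x * f x := by
  have hunion : Set.Ioc (0 : ℝ) 1 = ⋃ k : ℕ, {x ∈ Set.Ioc (0 : ℝ) 1 | gaussDigit x = k + 1} := by
    ext x
    simp only [Set.mem_iUnion, Set.mem_ofPred_eq, exists_and_left]
    refine ⟨fun hx => ⟨hx, gaussDigit x - 1, ?_⟩, fun h => h.1⟩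
    have : 1 ≤ gaussDigit x := Nat.one_le_floor_iff _ |>.2 ((one_le_inv₀ hx.1).2 hx.2)
    omega
  rw [lintegral_cylMeasure _ hf, restrict_Ioo_eq_restrict_Ioc]
  conv_lhs => rw [hunion]
  rw [lintegral_iUnion]
  · intro k
    exact measurableSet_Ioc.inter (measurable_gaussDigit (measurableSet_singleton _))
  · intro i j hij
    refine Set.disjoint_left.2 fun x hi hj => hij ?_
    have := hi.2.symm.trans hj.2
    omega

/-- Conditioning on the first digit: a bound uniform over all `cylMeasure`s is inherited. -/
lemma lintegral_digit_mul_comp_gaussMap_le {f : ℝ → ENNReal} (hf : Measurable f) {B : ENNReal}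
    (hB : ∀ c ∈ Set.Icc (0 : ℝ) 1, ∫⁻ x, f x ∂cylMeasure c ≤ B) (h : ℕ → ENNReal)
    {c : ℝ} (hc : 0 ≤ c) :
    ∫⁻ x, h (gaussDigit x) * f (gaussMap x) ∂cylMeasure c ≤
      (∫⁻ x, h (gaussDigit x) ∂cylMeasure c) * B := by
  have hh : Measurable fun x => h (gaussDigit x) := (measurable_of_countable h).comp
    measurable_gaussDigit
  rw [lintegral_cylMeasure_eq_tsum c (f := fun x => h (gaussDigit x) * f (gaussMap x)) (by fun_prop),
    lintegral_cylMeasure_eq_tsum c hh, ← ENNReal.tsum_mul_right]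
  refine ENNReal.tsum_le_tsum fun k => ?_
  have hms : MeasurableSet {x ∈ Set.Ioc (0 : ℝ) 1 | gaussDigit x = k + 1} :=
    measurableSet_Ioc.inter (measurable_gaussDigit (measurableSet_singleton _))
  have hpull (g : ℝ → ENNReal) (hg : Measurable g) :
      ∫⁻ x in {x ∈ Set.Ioc (0 : ℝ) 1 | gaussDigit x = k + 1},
        cylDensity c x * (h (gaussDigit x) * g (gaussMap x)) =
      h (k + 1) * (ENNReal.ofReal ((1 + c) / (((k + 1 : ℕ) + c) * ((k + 1 : ℕ) + c + 1))) *
        ∫⁻ y, g y ∂cylMeasure (1 / ((k + 1 : ℕ) + c))) := by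
    rw [← setLIntegral_gaussMap hc (Nat.le_add_left 1 k) hg, ← lintegral_const_mul _ (by fun_prop)]
    refine setLIntegral_congr_fun hms fun x hx => ?_
    rw [hx.2]
    ring
  have hk0 : (0 : ℝ) < (k + 1 : ℕ) + c := by positivity
  have hk1 : (1 : ℝ) ≤ (k + 1 : ℕ) + c := by
    push_cast
    linarith [(Nat.cast_nonneg k : (0 : ℝ) ≤ k)]
  have h1 := hpull 1 measurable_one
  simp only [Pi.one_apply, mul_one, lintegral_one] at h1
  rw [hpull f hf, h1, cylMeasure_univ (by positivity), mul_one, mul_assoc]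
  gcongr
  exact hB _ ⟨by positivity, (div_le_one hk0).2 hk1⟩

lemma lintegral_comp_gaussMap_le {f : ℝ → ENNReal} (hf : Measurable f) {B : ENNReal}
    (hB : ∀ c ∈ Set.Icc (0 : ℝ) 1, ∫⁻ x, f x ∂cylMeasure c ≤ B) {c : ℝ} (hc : 0 ≤ c) :
    ∫⁻ x, f (gaussMap x) ∂cylMeasure c ≤ B := by
  simpa [cylMeasure_univ hc] using lintegral_digit_mul_comp_gaussMap_le hf hB (fun _ => 1) hc

lemma half_le_cylDensity {c x : ℝ} (hc : c ∈ Set.Icc (0 : ℝ) 1) (hx : x ∈ Set.Ioo (0 : ℝ) 1) :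
    ENNReal.ofReal (1 / 2) ≤ cylDensity c x := by
  obtain ⟨⟨hc0, hc1⟩, hx0, hx1⟩ := hc, hx
  refine ENNReal.ofReal_le_ofReal ?_
  have h0 : 0 ≤ c * x := by positivity
  have h1 : c * x ≤ c := by nlinarith
  rw [div_le_div_iff₀ (by norm_num) (by positivity)]
  nlinarith

lemma cylDensity_le_two {c x : ℝ} (hc : c ∈ Set.Icc (0 : ℝ) 1) (hx : x ∈ Set.Ioo (0 : ℝ) 1) :
    cylDensity c x ≤ ENNReal.ofReal 2 := by
  obtain ⟨⟨hc0, hc1⟩, hx0, hx1⟩ := hc, hx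
  refine ENNReal.ofReal_le_ofReal ?_
  have h0 : 0 ≤ c * x := by positivity
  rw [div_le_iff₀ (by positivity)]
  nlinarith

/-- The Laplace transform of a digit reflects the non-integrability of its tail. -/
lemma lintegral_exp_neg_digit_le {t : ℝ} (ht0 : 0 < t) (ht1 : t ≤ 1) {c : ℝ}
    (hc : c ∈ Set.Icc (0 : ℝ) 1) :
    ∫⁻ x, ENNReal.ofReal (exp (-(t * gaussDigit x))) ∂cylMeasure c ≤
      ENNReal.ofReal (exp (-(t / 8 * log (1 / t)))) := by
  set u : ℝ → ENNReal := (Set.Ioo t 1).indicator fun x => ENNReal.ofReal (t / (4 * x)) with hu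
  have hum : Measurable u := Measurable.indicator (by fun_prop) measurableSet_Ioo
  have hem : Measurable fun x => ENNReal.ofReal (exp (-(t * gaussDigit x))) := by
    have : Measurable fun x => (gaussDigit x : ℝ) := by fun_prop
    fun_prop
  have hpt : ∀ x, ENNReal.ofReal (exp (-(t * gaussDigit x))) + u x ≤ 1 := by
    intro x
    by_cases hx : x ∈ Set.Ioo t 1
    · rw [hu, Set.indicator_of_mem hx, ← ENNReal.ofReal_add (exp_pos _).le
        (by have := ht0.trans hx.1; positivity), ← ENNReal.ofReal_one]
      refine ENNReal.ofReal_le_ofReal ?_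
      have hx0 : 0 < x := ht0.trans hx.1
      have hfl : 1 / (2 * x) ≤ gaussDigit x := by
        have h1 : (1 : ℝ) ≤ gaussDigit x := by
          exact_mod_cast (Nat.one_le_floor_iff _).2 ((one_le_inv₀ hx0).2 hx.2.le)
        have h2 : x⁻¹ < gaussDigit x + 1 := Nat.lt_floor_add_one _
        have h3 : 1 / (2 * x) = x⁻¹ / 2 := by field_simp
        rw [h3]
        linarith
      set v := t / (2 * x) with hv
      have hv0 : 0 ≤ v := by positivity
      have hv1 : v ≤ 1 := by
        rw [hv, div_le_one (by positivity)]
        linarith [hx.1]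
      have h1 : v ≤ t * gaussDigit x := by
        calc v = t * (1 / (2 * x)) := by rw [hv]; ring
          _ ≤ _ := by gcongr
      have h2 : exp (-(t * gaussDigit x)) ≤ exp (-v) := by gcongr
      have h3 : exp (-v) ≤ 1 - v / 2 := by
        rw [exp_neg, inv_le_comm₀ (exp_pos _) (by linarith)]
        refine le_trans ?_ (add_one_le_exp v)
        rw [inv_le_iff_one_le_mul₀ (by linarith)]
        nlinarith
      have h4 : t / (4 * x) = v / 2 := by rw [hv]; field_simp; norm_num
      rw [h4]
      linarith
    · rw [hu, Set.indicator_of_notMem hx, add_zero, ← ENNReal.ofReal_one]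
      refine ENNReal.ofReal_le_ofReal (exp_le_one_iff.2 ?_)
      have : 0 ≤ t * gaussDigit x := by positivity
      linarith
  have hlog : ENNReal.ofReal (t / 8 * log (1 / t)) ≤ ∫⁻ x, u x ∂cylMeasure c := by
    have hii : IntervalIntegrable (fun x : ℝ => t / 8 * x⁻¹) volume t 1 := by
      refine ContinuousOn.intervalIntegrable (continuousOn_const.mul (continuousOn_id.inv₀ ?_))
      intro x hx
      rw [Set.uIcc_of_le ht1] at hx
      exact (ht0.trans_le hx.1).ne'
    calc ENNReal.ofReal (t / 8 * log (1 / t))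
        = ∫⁻ x in Set.Ioc t 1, ENNReal.ofReal (t / 8 * x⁻¹) := by
          rw [← ofReal_integral_eq_lintegral_ofReal
            ((intervalIntegrable_iff_integrableOn_Ioc_of_le ht1).1 hii),
            ← intervalIntegral.integral_of_le ht1, intervalIntegral.integral_const_mul,
            integral_inv_of_pos ht0 one_pos]
          refine (ae_restrict_iff' measurableSet_Ioc).2 (Eventually.of_forall fun x hx => ?_)
          have := ht0.trans hx.1
          positivity
      _ = ∫⁻ x in Set.Ioo t 1, ENNReal.ofReal (t / 8 * x⁻¹) := by
          rw [restrict_Ioo_eq_restrict_Ioc]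
      _ ≤ ∫⁻ x in Set.Ioo t 1, cylDensity c x * u x := by
          refine setLIntegral_mono (by fun_prop) fun x hx => ?_
          have hx0 : 0 < x := ht0.trans hx.1
          rw [hu, Set.indicator_of_mem hx]
          refine le_trans (le_of_eq ?_) (mul_le_mul_left (half_le_cylDensity hc ⟨hx0, hx.2⟩) _)
          rw [← ENNReal.ofReal_mul (by norm_num)]
          congr 1
          field_simp
          norm_num
      _ ≤ ∫⁻ x in Set.Ioo 0 1, cylDensity c x * u x :=
          lintegral_mono_set (Set.Ioo_subset_Ioo_left ht0.le)
      _ = _ := (lintegral_cylMeasure c hum).symm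
  have hsum : ∫⁻ x, ENNReal.ofReal (exp (-(t * gaussDigit x))) ∂cylMeasure c +
      ∫⁻ x, u x ∂cylMeasure c ≤ 1 := by
    rw [← lintegral_add_left hem]
    calc _ ≤ ∫⁻ _, 1 ∂cylMeasure c := lintegral_mono hpt
      _ = 1 := by rw [lintegral_one, cylMeasure_univ hc.1]
  have hnn : 0 ≤ t / 8 * log (1 / t) :=
    mul_nonneg (by positivity) (log_nonneg ((one_le_div ht0).2 ht1))
  calc _ ≤ 1 - ENNReal.ofReal (t / 8 * log (1 / t)) :=
        ENNReal.le_sub_of_add_le_right ENNReal.ofReal_ne_top ((add_le_add_right hlog _).trans hsum)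
    _ = ENNReal.ofReal (1 - t / 8 * log (1 / t)) := by
        rw [ENNReal.ofReal_sub _ hnn, ENNReal.ofReal_one]
    _ ≤ _ := ENNReal.ofReal_le_ofReal (one_sub_le_exp_neg _)

lemma exists_lintegral_digit_rpow_le {r : ℝ} (hr0 : 0 < r) (hr1 : r < 1) :
    ∃ C : ENNReal, C ≠ ⊤ ∧ ∀ c ∈ Set.Icc (0 : ℝ) 1,
      ∫⁻ x, ENNReal.ofReal (((gaussDigit x : ℝ) + 2) ^ r) ∂cylMeasure c ≤ C := by
  have hm : Measurable fun x => ENNReal.ofReal (((gaussDigit x : ℝ) + 2) ^ r) := by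
    have : Measurable fun x => (gaussDigit x : ℝ) := by fun_prop
    fun_prop
  refine ⟨∫⁻ x in Set.Ioo 0 1, ENNReal.ofReal (2 * 3 ^ r * x ^ (-r)), ?_, fun c hc => ?_⟩
  · have hii : IntervalIntegrable (fun x : ℝ => 2 * 3 ^ r * x ^ (-r)) volume 0 1 :=
      (intervalIntegral.intervalIntegrable_rpow' (by linarith)).const_mul _
    rw [restrict_Ioo_eq_restrict_Ioc]
    exact ((intervalIntegrable_iff_integrableOn_Ioc_of_le zero_le_one).1 hii).lintegral_lt_top.ne
  · rw [lintegral_cylMeasure c hm]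
    refine setLIntegral_mono (by fun_prop) fun x hx => ?_
    refine (mul_le_mul_left (cylDensity_le_two hc hx) _).trans ?_
    rw [← ENNReal.ofReal_mul (by norm_num)]
    refine ENNReal.ofReal_le_ofReal ?_
    rw [rpow_neg hx.1.le, ← inv_rpow hx.1.le, mul_assoc, ← mul_rpow (by norm_num)
      (inv_nonneg.2 hx.1.le)]
    have h1 : (gaussDigit x : ℝ) ≤ x⁻¹ := Nat.floor_le (inv_nonneg.2 hx.1.le)
    have h2 : 1 ≤ x⁻¹ := (one_le_inv₀ hx.1).2 hx.2.le
    gcongr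
    linarith

lemma lintegral_comp_gaussMap_iterate_le {f : ℝ → ENNReal} (hf : Measurable f) {B : ENNReal}
    (hB : ∀ c ∈ Set.Icc (0 : ℝ) 1, ∫⁻ x, f x ∂cylMeasure c ≤ B) (n : ℕ) :
    ∀ c ∈ Set.Icc (0 : ℝ) 1, ∫⁻ x, f (gaussMap^[n] x) ∂cylMeasure c ≤ B := by
  induction n with
  | zero => exact hB
  | succ n ih =>
    intro c hc
    exact lintegral_comp_gaussMap_le (f := fun x => f (gaussMap^[n] x)) (by fun_prop) ih hc.1

/-- The sum of the first `m` digits with odd index. -/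
noncomputable def oddDigitSum (m : ℕ) (x : ℝ) : ℕ :=
  ∑ j ∈ Finset.range m, gaussDigit (gaussMap^[2 * j] x)

/-- The sum of `(a + 2) ^ p` over the first `m` digits `a` with even index. -/
noncomputable def evenDigitPowSum (p : ℝ) (m : ℕ) (x : ℝ) : ℝ :=
  ∑ j ∈ Finset.range m, ((gaussDigit (gaussMap^[2 * j + 1] x) : ℝ) + 2) ^ p

@[fun_prop]
lemma measurable_oddDigitSum (m : ℕ) : Measurable (oddDigitSum m) := by
  unfold oddDigitSum
  fun_prop

@[fun_prop]
lemma measurable_evenDigitPowSum (p : ℝ) (m : ℕ) : Measurable (evenDigitPowSum p m) := by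
  unfold evenDigitPowSum
  refine Finset.measurable_sum _ fun j _ => ?_
  have : Measurable fun x => (gaussDigit (gaussMap^[2 * j + 1] x) : ℝ) := by fun_prop
  fun_prop

lemma oddDigitSum_succ (m : ℕ) (x : ℝ) :
    oddDigitSum (m + 1) x = gaussDigit x + oddDigitSum m (gaussMap (gaussMap x)) := by
  rw [oddDigitSum, Finset.sum_range_succ', add_comm]
  rfl

lemma evenDigitPowSum_succ (p : ℝ) (m : ℕ) (x : ℝ) :
    evenDigitPowSum p (m + 1) x =
      ((gaussDigit (gaussMap x) : ℝ) + 2) ^ p + evenDigitPowSum p m (gaussMap (gaussMap x)) := by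
  rw [evenDigitPowSum, Finset.sum_range_succ', add_comm]
  rfl

lemma lintegral_exp_neg_oddDigitSum_le {t : ℝ} (ht0 : 0 < t) (ht1 : t ≤ 1) (m : ℕ) :
    ∀ c ∈ Set.Icc (0 : ℝ) 1,
      ∫⁻ x, ENNReal.ofReal (exp (-(t * oddDigitSum m x))) ∂cylMeasure c ≤
        ENNReal.ofReal (exp (-(t / 8 * log (1 / t)))) ^ m := by
  induction m with
  | zero =>
    intro c hc
    simp [oddDigitSum, cylMeasure_univ hc.1]
  | succ m ih =>
    intro c hc
    have hm : Measurable fun x => ENNReal.ofReal (exp (-(t * oddDigitSum m x))) := by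
      have : Measurable fun x => (oddDigitSum m x : ℝ) := by fun_prop
      fun_prop
    have hstep := lintegral_digit_mul_comp_gaussMap_le (hm.comp measurable_gaussMap)
      (fun c hc => lintegral_comp_gaussMap_le hm ih hc.1)
      (fun k => ENNReal.ofReal (exp (-(t * k)))) hc.1
    rw [pow_succ']
    refine le_trans (le_of_eq ?_)
      (hstep.trans (mul_le_mul_left (lintegral_exp_neg_digit_le ht0 ht1 hc) _))
    refine lintegral_congr fun x => ?_
    simp only [Function.comp]
    rw [← ENNReal.ofReal_mul (exp_pos _).le, ← exp_add, oddDigitSum_succ]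
    push_cast
    ring_nf

lemma ae_tendsto_zero_of_tsum_lintegral_ne_top {α : Type*} [MeasurableSpace α] {μ : Measure α}
    {f : ℕ → α → ENNReal} (hf : ∀ i, Measurable (f i)) (h : ∑' i, ∫⁻ x, f i x ∂μ ≠ ⊤) :
    ∀ᵐ x ∂μ, Tendsto (fun i => f i x) atTop (nhds 0) := by
  rw [← lintegral_tsum fun i => (hf i).aemeasurable] at h
  filter_upwards [ae_lt_top (Measurable.tsum hf) h] with x hx
  exact ENNReal.tendsto_atTop_zero_of_tsum_ne_top hx.ne

lemma ae_eventually_le_oddDigitSum :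
    ∀ᵐ x ∂(volume.restrict (Set.Ioo (0 : ℝ) 1)),
      ∀ᶠ i : ℕ in atTop, (1 / 32 : ℝ) * (i * 4 ^ i) ≤ oddDigitSum (4 ^ i) x := by
  rw [← cylMeasure_zero]
  set f : ℕ → ℝ → ENNReal := fun i x =>
    ENNReal.ofReal (exp (i * 2 ^ i / 32)) *
      ENNReal.ofReal (exp (-((1 / 2) ^ i * oddDigitSum (4 ^ i) x))) with hf
  have hfm : ∀ i, Measurable (f i) := by
    intro i
    have : Measurable fun x => (oddDigitSum (4 ^ i) x : ℝ) := by fun_prop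
    fun_prop
  have hpow (i : ℕ) : (1 / 2 : ℝ) ^ i * 4 ^ i = 2 ^ i := by rw [← mul_pow]; norm_num
  have hint (i : ℕ) : ∫⁻ x, f i x ∂cylMeasure 0 ≤ ENNReal.ofReal (exp (i * (-1 / 32))) := by
    have h0 := lintegral_exp_neg_oddDigitSum_le (t := (1 / 2) ^ i) (by positivity)
      (pow_le_one₀ (by norm_num) (by norm_num)) (4 ^ i) 0 ⟨le_rfl, zero_le_one⟩
    rw [hf, lintegral_const_mul' _ _ ENNReal.ofReal_ne_top]
    refine (mul_le_mul_right h0 _).trans ?_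
    rw [← ENNReal.ofReal_pow (exp_pos _).le, ← ENNReal.ofReal_mul (exp_pos _).le, ← exp_nat_mul,
      ← exp_add]
    refine ENNReal.ofReal_le_ofReal (exp_le_exp.2 ?_)
    have hl : log (1 / (1 / 2) ^ i) = i * log 2 := by
      rw [one_div_pow, one_div_one_div, log_pow]
    rw [hl]
    push_cast
    have e : (4 : ℝ) ^ i * -((1 / 2) ^ i / 8 * (i * log 2)) =
        -(2 ^ i * i * (log 2 / 8)) := by
      rw [← hpow i]
      ring
    rw [e]
    have hlog := log_two_gt_d9
    have h1 : (1 : ℝ) ≤ 2 ^ i := one_le_pow₀ (by norm_num)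
    have h2 : (i : ℝ) ≤ 2 ^ i * i := le_mul_of_one_le_left (by positivity) h1
    have h3 : (2 ^ i * i : ℝ) * (1 / 16) ≤ 2 ^ i * i * (log 2 / 8) :=
      mul_le_mul_of_nonneg_left (by linarith) (by positivity)
    linarith
  have hsum : ∑' i, ∫⁻ x, f i x ∂cylMeasure 0 ≠ ⊤ :=
    ne_top_of_le_ne_top (Real.summable_exp_nat_mul_iff.2 (by norm_num)).tsum_ofReal_ne_top
      (ENNReal.tsum_le_tsum hint)
  filter_upwards [ae_tendsto_zero_of_tsum_lintegral_ne_top hfm hsum] with x hx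
  filter_upwards [hx.eventually_lt_const one_pos] with i hi
  rw [hf] at hi
  simp only at hi
  rw [← ENNReal.ofReal_mul (exp_pos _).le, ← exp_add, ENNReal.ofReal_lt_one, exp_lt_one_iff] at hi
  have h4 : (4 : ℝ) ^ i = 2 ^ i * 2 ^ i := by rw [← mul_pow]; norm_num
  have h5 : (1 / 2 : ℝ) ^ i * 2 ^ i = 1 := by rw [← mul_pow]; norm_num
  have h6 : (0 : ℝ) < 2 ^ i := by positivity
  have h7 : (2 : ℝ) ^ i * (i * 2 ^ i / 32 + -((1 / 2) ^ i * oddDigitSum (4 ^ i) x)) < 0 :=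
    mul_neg_of_pos_of_neg h6 hi
  have h8 : (2 : ℝ) ^ i * (i * 2 ^ i / 32 + -((1 / 2) ^ i * oddDigitSum (4 ^ i) x)) =
      i * (2 ^ i * 2 ^ i) / 32 - (1 / 2) ^ i * 2 ^ i * oddDigitSum (4 ^ i) x := by ring
  rw [h4]
  rw [h8, h5] at h7
  linarith

lemma ae_tendsto_evenDigitPowSum {p : ℝ} (hp0 : 0 < p) (hp1 : p < 1) :
    ∀ᵐ x ∂(volume.restrict (Set.Ioo (0 : ℝ) 1)),
      Tendsto (fun i : ℕ => evenDigitPowSum p (4 ^ i) x / (((i : ℝ) + 1) * 4 ^ i)) atTop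
        (nhds 0) := by
  obtain ⟨r, hpr, hr1⟩ := exists_between hp1
  have hr0 : 0 < r := hp0.trans hpr
  obtain ⟨q, hq⟩ : ∃ q, q = r / p := ⟨_, rfl⟩
  have hq1 : 1 < q := hq ▸ (one_lt_div hp0).2 hpr
  have hpq : p * q = r := by rw [hq]; field_simp
  obtain ⟨C, hC, hCle⟩ := exists_lintegral_digit_rpow_le hr0 hr1
  have hm0 : Measurable fun x => ENNReal.ofReal (((gaussDigit x : ℝ) + 2) ^ r) := by
    have : Measurable fun x => (gaussDigit x : ℝ) := by fun_prop
    fun_prop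
  rw [← cylMeasure_zero]
  have hS0 (m : ℕ) (x : ℝ) : 0 ≤ evenDigitPowSum p m x :=
    Finset.sum_nonneg fun j _ => by positivity
  set f : ℕ → ℝ → ENNReal := fun i x =>
    ENNReal.ofReal ((evenDigitPowSum p (4 ^ i) x / (((i : ℝ) + 1) * 4 ^ i)) ^ q) with hf
  have hfm : ∀ i, Measurable (f i) := by
    intro i
    fun_prop
  have hint (i : ℕ) : ∫⁻ x, f i x ∂cylMeasure 0 ≤
      ENNReal.ofReal (1 / ((i + 1 : ℕ) : ℝ) ^ q) * C := by
    set N : ℕ := 4 ^ i with hN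
    have hN0 : (0 : ℝ) < N := by rw [hN]; positivity
    calc ∫⁻ x, f i x ∂cylMeasure 0
        ≤ ∫⁻ x, ENNReal.ofReal (1 / ((i + 1 : ℕ) : ℝ) ^ q / N) * ∑ j ∈ Finset.range N,
            ENNReal.ofReal (((gaussDigit (gaussMap^[2 * j + 1] x) : ℝ) + 2) ^ r)
              ∂cylMeasure 0 := by
          refine lintegral_mono fun x => ?_
          rw [← ENNReal.ofReal_sum_of_nonneg fun j _ => by positivity,
            ← ENNReal.ofReal_mul (by positivity)]
          refine ENNReal.ofReal_le_ofReal ?_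
          have hJ := Real.rpow_sum_le_const_mul_sum_rpow_of_nonneg (s := Finset.range N)
            (f := fun j => ((gaussDigit (gaussMap^[2 * j + 1] x) : ℝ) + 2) ^ p) hq1.le
            (fun j _ => by positivity)
          simp only [Finset.card_range] at hJ
          have hJ' : evenDigitPowSum p N x ^ q ≤ (N : ℝ) ^ (q - 1) * ∑ j ∈ Finset.range N,
              ((gaussDigit (gaussMap^[2 * j + 1] x) : ℝ) + 2) ^ r := by
            refine hJ.trans (le_of_eq ?_)
            congr 1
            refine Finset.sum_congr rfl fun j _ => ?_
            rw [← rpow_mul (by positivity), hpq]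
          have hN4 : (4 : ℝ) ^ i = N := by rw [hN]; push_cast; rfl
          rw [hN4, div_rpow (hS0 _ _) (by positivity), mul_rpow (by positivity) hN0.le]
          rw [div_le_iff₀ (by positivity)]
          refine hJ'.trans (le_of_eq ?_)
          rw [rpow_sub_one hN0.ne']
          push_cast
          field_simp
      _ ≤ ENNReal.ofReal (1 / ((i + 1 : ℕ) : ℝ) ^ q / N) * (N * C) := by
          rw [lintegral_const_mul' _ _ ENNReal.ofReal_ne_top]
          gcongr
          have hmj (j : ℕ) : Measurable fun x =>
              ENNReal.ofReal (((gaussDigit (gaussMap^[2 * j + 1] x) : ℝ) + 2) ^ r) :=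
            hm0.comp (measurable_gaussMap_iterate _)
          rw [lintegral_finsetSum _ fun j _ => hmj j]
          refine (Finset.sum_le_card_nsmul _ _ C fun j _ => ?_).trans (by simp)
          exact lintegral_comp_gaussMap_iterate_le hm0 hCle _ 0 ⟨le_rfl, zero_le_one⟩
      _ = _ := by
          rw [← mul_assoc, ← ENNReal.ofReal_natCast, ← ENNReal.ofReal_mul (by positivity),
            div_mul_cancel₀ _ hN0.ne']
  have hsum : ∑' i, ∫⁻ x, f i x ∂cylMeasure 0 ≠ ⊤ := by
    refine ne_top_of_le_ne_top ?_ (ENNReal.tsum_le_tsum hint)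
    rw [ENNReal.tsum_mul_right]
    refine ENNReal.mul_ne_top (Summable.tsum_ofReal_ne_top ?_) hC
    exact (summable_nat_add_iff 1).2 (Real.summable_one_div_nat_rpow.2 hq1)
  filter_upwards [ae_tendsto_zero_of_tsum_lintegral_ne_top hfm hsum] with x hx
  have hx' := (ENNReal.continuousAt_toReal ENNReal.zero_ne_top).tendsto.comp hx
  have hx'' := hx'.rpow_const (p := 1 / q) (Or.inr (by positivity))
  rw [ENNReal.toReal_zero, zero_rpow (by positivity)] at hx''
  refine hx''.congr fun i => ?_
  have h0 : 0 ≤ evenDigitPowSum p (4 ^ i) x / (((i : ℝ) + 1) * 4 ^ i) :=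
    div_nonneg (hS0 _ _) (by positivity)
  simp only [Function.comp, hf]
  rw [ENNReal.toReal_ofReal (by positivity), ← rpow_mul h0, mul_one_div_cancel (by positivity),
    rpow_one]

lemma irrational_gaussMap {z : ℝ} (hz : Irrational z) : Irrational (gaussMap z) :=
  hz.inv.sub_intCast _

lemma gaussMap_mem_Ioo {z : ℝ} (hz : Irrational z) : gaussMap z ∈ Set.Ioo (0 : ℝ) 1 :=
  ⟨(Int.fract_nonneg _).lt_of_ne (irrational_gaussMap hz).ne_zero.symm, Int.fract_lt_one _⟩

lemma inv_eq_gaussDigit_add_gaussMap {z : ℝ} (hz : 0 < z) :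
    z⁻¹ = gaussDigit z + gaussMap z := by
  rw [gaussDigit, gaussMap, natCast_floor_eq_intCast_floor (by positivity), Int.floor_add_fract]

lemma negT_of_one_div_eq {y v : ℝ} {n : ℕ} (hv : v ∈ Set.Ioo (0 : ℝ) 1) (hy : 1 / y = n + v) :
    negT y = 1 - v := by
  rw [negT, neg_div, hy, Int.fract_eq_iff]
  exact ⟨by linarith [hv.2], by linarith [hv.1], -(n : ℤ) - 1, by push_cast; ring⟩

lemma toNat_ceil_of_one_div_eq {y v : ℝ} {n : ℕ} (hv : v ∈ Set.Ioo (0 : ℝ) 1)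
    (hy : 1 / y = n + v) : (⌈1 / y⌉).toNat = n + 1 := by
  have : ⌈1 / y⌉ = ((n + 1 : ℕ) : ℤ) := by
    rw [hy, Int.ceil_eq_iff]
    push_cast
    exact ⟨by linarith [hv.1], by linarith [hv.2]⟩
  rw [this, Int.toNat_natCast]

/-- The excess over `2 ^ p` of the first `n` negative continued fraction digits, raised to the
power `p`, of the point `y` (as opposed to `1 - y`). -/
noncomputable def negExcess (p : ℝ) (n : ℕ) (y : ℝ) : ℝ :=
  ∑ k ∈ Finset.range n, (((⌈1 / negT^[k] y⌉).toNat : ℝ) ^ p - 2 ^ p)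

lemma negExcess_succ (p : ℝ) (n : ℕ) (y : ℝ) :
    negExcess p (n + 1) y = (((⌈1 / y⌉).toNat : ℝ) ^ p - 2 ^ p) + negExcess p n (negT y) := by
  rw [negExcess, Finset.sum_range_succ', add_comm]
  rfl

/-- A regular digit `a` of odd index produces `a - 1` negative digits `2`, and a regular digit `b`
of even index produces one negative digit `b + 2`. -/
lemma negExcess_mem_Icc {p : ℝ} (hp : 0 < p) (n : ℕ) :
    ∀ (m : ℕ) (z : ℝ), z ∈ Set.Ioo (0 : ℝ) 1 → Irrational z → n ≤ oddDigitSum m z →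
      negExcess p n (1 - z) ∈ Set.Icc 0 (evenDigitPowSum p m z) := by
  induction n with
  | zero =>
    intro m z _ _ _
    simp only [negExcess, Finset.range_zero, Finset.sum_empty, Set.mem_Icc, le_refl, true_and]
    exact Finset.sum_nonneg fun j _ => by positivity
  | succ n ih =>
    intro m z hz hirr hn
    obtain _ | m := m
    · simp [oddDigitSum] at hn
    have hz0 := hz.1
    have hz1 := hz.2
    have ha := inv_eq_gaussDigit_add_gaussMap hz0
    have hu := gaussMap_mem_Ioo hirr
    have hiu := irrational_gaussMap hirr
    have hone : 1 ≤ gaussDigit z := (Nat.one_le_floor_iff _).2 ((one_le_inv₀ hz0).2 hz1.le)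
    rw [oddDigitSum_succ] at hn
    rw [evenDigitPowSum_succ, negExcess_succ]
    obtain h1 | h2 := hone.eq_or_lt
    · have hb := inv_eq_gaussDigit_add_gaussMap hu.1
      have hv := gaussMap_mem_Ioo hiu
      have hdiv : 1 / (1 - z) = (gaussDigit (gaussMap z) + 1 : ℕ) + gaussMap (gaussMap z) := by
        have hu0 := hu.1
        rw [← h1, Nat.cast_one] at ha
        have hz' : z = (1 + gaussMap z)⁻¹ := by rw [← ha, inv_inv]
        have e : 1 - z = gaussMap z / (1 + gaussMap z) := by
          conv_lhs => rw [hz']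
          field_simp
          ring
        have e2 : 1 / (1 - z) = (gaussMap z)⁻¹ + 1 := by
          rw [e]
          field_simp
        rw [e2, hb]
        push_cast
        ring
      rw [negT_of_one_div_eq hv hdiv, toNat_ceil_of_one_div_eq hv hdiv]
      obtain ⟨hl, hr⟩ := ih m _ hv (irrational_gaussMap hiu) (by omega)
      have hbd : ((gaussDigit (gaussMap z) + 1 + 1 : ℕ) : ℝ) = gaussDigit (gaussMap z) + 2 := by
        push_cast
        ring
      rw [hbd]
      have hge : (2 : ℝ) ^ p ≤ ((gaussDigit (gaussMap z) : ℝ) + 2) ^ p := by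
        gcongr
        exact le_add_of_nonneg_left (Nat.cast_nonneg _)
      have hpos : (0 : ℝ) < 2 ^ p := by positivity
      exact ⟨by linarith, by linarith⟩
    · have h2' : (2 : ℝ) ≤ gaussDigit z := by exact_mod_cast h2
      have hinv : 2 < z⁻¹ := by
        rw [ha]
        linarith [hu.1]
      set w := (z⁻¹ - 1)⁻¹ with hw
      have hwirr : Irrational w := by
        rw [hw, irrational_inv_iff]
        simpa using hirr.inv.sub_intCast 1
      have hw01 : w ∈ Set.Ioo (0 : ℝ) 1 :=
        ⟨inv_pos.2 (by linarith), inv_lt_one_of_one_lt₀ (by linarith)⟩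
      have hdiv : 1 / (1 - z) = (1 : ℕ) + w := by
        have h3 : 1 - z ≠ 0 := by linarith
        have h4 : z⁻¹ - 1 = (1 - z) / z := by field_simp
        rw [hw, h4]
        push_cast
        field_simp
        ring
      have hwinv : w⁻¹ = z⁻¹ - 1 := inv_inv _
      have hwG : gaussMap w = gaussMap z := by
        rw [gaussMap, hwinv, Int.fract_sub_one, gaussMap]
      have hwa : gaussDigit w + 1 = gaussDigit z := by
        have := inv_eq_gaussDigit_add_gaussMap hw01.1
        rw [hwinv, ha, hwG] at this
        have : (gaussDigit w : ℝ) + 1 = gaussDigit z := by linarith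
        exact_mod_cast this
      rw [negT_of_one_div_eq hw01 hdiv, toNat_ceil_of_one_div_eq hw01 hdiv]
      have := ih (m + 1) w hw01 hwirr (by rw [oddDigitSum_succ, hwG]; omega)
      rw [evenDigitPowSum_succ, hwG] at this
      norm_num
      exact this

/-- Averages of `E` are controlled along a sparse sequence of times `S i`. -/
lemma tendsto_div_natCast_of_sparse {E : ℕ → ℝ} {S : ℕ → ℕ} {F : ℕ → ℝ} (hSm : Monotone S)
    (hE : ∀ n i, n ≤ S i → E n ∈ Set.Icc 0 (F i)) {δ : ℝ} (hδ : 0 < δ)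
    (hS : ∀ᶠ i : ℕ in atTop, δ * (i * 4 ^ i) ≤ S i)
    (hF : Tendsto (fun i : ℕ => F i / (((i : ℝ) + 1) * 4 ^ i)) atTop (nhds 0)) :
    Tendsto (fun n : ℕ => E n / n) atTop (nhds 0) := by
  have hSt : Tendsto S atTop atTop := by
    rw [← tendsto_natCast_atTop_iff (R := ℝ)]
    refine tendsto_atTop_mono' _ hS (Tendsto.const_mul_atTop hδ ?_)
    refine tendsto_atTop_mono (fun i => ?_) (tendsto_natCast_atTop_atTop (R := ℝ))
    exact le_mul_of_one_le_right (by positivity) (one_le_pow₀ (by norm_num))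
  have hE0 (n : ℕ) : 0 ≤ E n := by
    obtain ⟨i, hi⟩ := (hSt.eventually_ge_atTop n).exists
    exact (hE n i hi).1
  have hratio (ε : ℝ) (hε : 0 < ε) : ∀ᶠ i : ℕ in atTop, F (i + 1) ≤ ε * S i := by
    have hF' := (hF.comp (tendsto_add_atTop_nat 1)).eventually_le_const
      (show 0 < ε * δ / 12 by positivity)
    filter_upwards [hF', hS, eventually_ge_atTop 1] with i hi hSi hi1
    simp only [Function.comp] at hi
    rw [div_le_iff₀ (by positivity)] at hi
    have hi1' : (1 : ℝ) ≤ i := by exact_mod_cast hi1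
    calc F (i + 1) ≤ _ := hi
      _ = ε * δ / 3 * 4 ^ i * (i + 2) := by push_cast; ring
      _ ≤ ε * δ / 3 * 4 ^ i * (3 * i) := by gcongr; linarith
      _ = ε * (δ * (i * 4 ^ i)) := by ring
      _ ≤ ε * S i := by gcongr
  refine tendsto_order.2 ⟨fun a ha => Eventually.of_forall fun n =>
    ha.trans_le (div_nonneg (hE0 n) (Nat.cast_nonneg n)), fun ε hε => ?_⟩
  obtain ⟨i₀, hi₀⟩ := eventually_atTop.1 (hratio (ε / 2) (by positivity))
  filter_upwards [eventually_gt_atTop (S i₀)] with n hn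
  have hex : ∃ i, n ≤ S i := (hSt.eventually_ge_atTop n).exists
  classical
  have hspec := Nat.find_spec hex
  have hlt : i₀ < Nat.find hex := by
    by_contra! hle
    exact (hspec.trans (hSm hle)).not_gt hn
  obtain ⟨i, hi⟩ : ∃ i, Nat.find hex = i + 1 := ⟨Nat.find hex - 1, by omega⟩
  rw [hi] at hspec
  have hmin : S i < n := not_le.1 (Nat.find_min hex (by omega))
  have hnpos : (0 : ℝ) < n := by exact_mod_cast (Nat.zero_le _).trans_lt hn
  rw [div_lt_iff₀ hnpos]
  calc E n ≤ F (i + 1) := (hE n _ hspec).2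
    _ ≤ ε / 2 * S i := hi₀ i (by omega)
    _ ≤ ε / 2 * n := by gcongr
    _ < ε * n := by nlinarith

/-- For `0 < p < 1`, the generalized `p`-mean of the negative continued fraction
digits converges to `2` almost everywhere. -/
theorem negDigit_pMean_tendsto_two (p : ℝ) (hp0 : 0 < p) (hp1 : p < 1) :
    ∀ᵐ x ∂(volume.restrict (Set.Ioo (0 : ℝ) 1)), Irrational x →
      Tendsto
        (fun n : ℕ =>
          ((1 / n : ℝ) * ∑ k ∈ Finset.Icc 1 n, (negDigit x k : ℝ) ^ p) ^ (1 / p))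
        atTop (nhds 2) := by
  filter_upwards [ae_eventually_le_oddDigitSum, ae_tendsto_evenDigitPowSum hp0 hp1,
    ae_restrict_mem measurableSet_Ioo] with x hS hF hx hirr
  have hmono : Monotone fun i : ℕ => oddDigitSum (4 ^ i) x := by
    intro i j hij
    exact Finset.sum_le_sum_of_subset
      (Finset.range_subset_range.2 (Nat.pow_le_pow_right (by norm_num) hij))
  have hE := tendsto_div_natCast_of_sparse (E := fun n => negExcess p n (1 - x)) hmono
    (fun n i hn => negExcess_mem_Icc hp0 n (4 ^ i) x hx hirr hn) (by norm_num) hS hF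
  have hlim : Tendsto (fun n : ℕ => (1 / n : ℝ) * ∑ k ∈ Finset.Icc 1 n, (negDigit x k : ℝ) ^ p)
      atTop (nhds (2 ^ p)) := by
    have := hE.add_const ((2 : ℝ) ^ p)
    rw [zero_add] at this
    refine this.congr' ?_
    filter_upwards [eventually_gt_atTop 0] with n hn
    have hn' : (n : ℝ) ≠ 0 := by positivity
    have hsum : ∑ k ∈ Finset.Icc 1 n, (negDigit x k : ℝ) ^ p =
        negExcess p n (1 - x) + n * 2 ^ p := by
      rw [← Finset.Ico_add_one_right_eq_Icc, Finset.sum_Ico_eq_sum_range]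
      simp [negExcess, negDigit]
    rw [hsum]
    field_simp
  have := hlim.rpow_const (p := 1 / p) (Or.inr (by positivity))
  rwa [← rpow_mul (by norm_num), mul_one_div_cancel hp0.ne', rpow_one] at this
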